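/- In a binary-conflict-free net N, if P —a→ P' and P —b→ Q with a ≠ b for finite GR-processes, then the step {a,b} is enabled at ĤP, and there exists Q' with P' —b→ Q' and Q —a→ ≡₁* Q' (i.e., some Q'' with Q —a→ Q'' ≡₁* Q'). -/

import Mathlib

/-- A place/transition net: places `S`, transitions `T`, flow relation given by
`pre t s = F(s,t)` and `post t s = F(t,s)`, and initial marking `M0`. Every
transition has a finite non-empty multiset of preplaces and a finite multiset
of postplaces. -/
structure Net where
  S : Type
  T : Type
  pre : T → S → ℕ
  post : T → S → ℕ
  M0 : S → ℕ
  pre_fin : ∀ t, (Function.support (pre t)).Finite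
  pre_ne : ∀ t, ∃ s, 0 < pre t s
  post_fin : ∀ t, (Function.support (post t)).Finite

namespace Net

/-- `•G`, the preset of a finite multiset of transitions. -/
def preStep (N : Net) (G : N.T →₀ ℕ) : N.S → ℕ := fun s => G.sum fun t n => n * N.pre t s

/-- `G•`, the postset of a finite multiset of transitions. -/
def postStep (N : Net) (G : N.T →₀ ℕ) : N.S → ℕ := fun s => G.sum fun t n => n * N.post t s

/-- `G` is enabled at marking `M` : `•G ⊆ M`. -/
def Enabled (N : Net) (M : N.S → ℕ) (G : N.T →₀ ℕ) : Prop := ∀ s, N.preStep G s ≤ M s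

/-- `M —G→ M'` : the non-empty finite multiset `G` is a step from `M` to `M'`. -/
def Step (N : Net) (M : N.S → ℕ) (G : N.T →₀ ℕ) (M' : N.S → ℕ) : Prop :=
  G ≠ 0 ∧ N.Enabled M G ∧ ∀ s, M' s = M s - N.preStep G s + N.postStep G s

/-- Firing a single transition. -/
def Fire (N : Net) (M : N.S → ℕ) (t : N.T) (M' : N.S → ℕ) : Prop :=
  N.Step M (Finsupp.single t 1) M'

/-- Markings reachable from the initial marking by firing single transitions. -/
def Reachable (N : Net) (M : N.S → ℕ) : Prop :=
  Relation.ReflTransGen (fun M₁ M₂ => ∃ t, N.Fire M₁ t M₂) N.M0 M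

/-- The finite non-empty multiset `G` is in semantic conflict at `M`. -/
def Conflict (N : Net) (M : N.S → ℕ) (G : N.T →₀ ℕ) : Prop :=
  G ≠ 0 ∧ ¬ N.Enabled M G ∧ ∀ t, 0 < G t → N.Enabled M (Finsupp.single t (G t))

def ConflictFree (N : Net) : Prop := ∀ M, N.Reachable M → ∀ G, ¬ N.Conflict M G

def BinaryConflictFree (N : Net) : Prop :=
  ∀ M, N.Reachable M → ∀ G : N.T →₀ ℕ, (G.sum fun _ n => n) = 2 → ¬ N.Conflict M G

/-- Structural conflict net: transitions occurring together in a step at a reachable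
marking have disjoint presets. -/
def StructuralConflictNet (N : Net) : Prop :=
  ∀ t u : N.T,
    (∃ M, N.Reachable M ∧ N.Enabled M (Finsupp.single t 1 + Finsupp.single u 1)) →
    ∀ s, min (N.pre t s) (N.pre u s) = 0

/-- A sufficiently large ambient type from which the places and transitions of
GR-processes of `N` are drawn. -/
def Amb (N : Net) : Type := Set (N.S ⊕ N.T ⊕ ℕ)

end Net
/-- Raw data of a (Goltz-Reisig) process over a net `N` : an occurrence net
with places `pl` and transitions `tr` (subsets of an ambient type), flow
`Fst` (place → transition) and `Fts` (transition → place), and the process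
mapping `piS`, `piT` into `N`. -/
structure RawProc (N : Net) where
  pl : Set N.Amb
  tr : Set N.Amb
  Fst : N.Amb → N.Amb → ℕ
  Fts : N.Amb → N.Amb → ℕ
  piS : N.Amb → N.S
  piT : N.Amb → N.T

namespace RawProc

variable {N : Net}

/-- The flow relation of the process (places tagged `inl`, transitions `inr`). -/
def rel (P : RawProc N) : (N.Amb ⊕ N.Amb) → (N.Amb ⊕ N.Amb) → Prop
  | Sum.inl x, Sum.inr t => 0 < P.Fst x t
  | Sum.inr t, Sum.inl x => 0 < P.Fts t x
  | _, _ => False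

/-- The causal order `ℱ⁺` of the process. -/
def causal (P : RawProc N) : (N.Amb ⊕ N.Amb) → (N.Amb ⊕ N.Amb) → Prop :=
  Relation.TransGen P.rel

/-- The initially marked places: those with empty preset. -/
def init (P : RawProc N) : Set N.Amb := {x | x ∈ P.pl ∧ ∀ t, P.Fts t x = 0}

/-- The end `P°` of the process: places with empty postset. -/
def ends (P : RawProc N) : Set N.Amb := {x | x ∈ P.pl ∧ ∀ t, P.Fst x t = 0}

/-- The marking `ĤP = π(P°)` of the underlying net reached at the end of `P`. -/
noncomputable def endMark (P : RawProc N) : N.S → ℕ :=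
  fun s => {x | x ∈ P.ends ∧ P.piS x = s}.ncard

/-- A process is finite iff its set of transitions is finite. -/
def FiniteP (P : RawProc N) : Prop := P.tr.Finite

open Classical in
/-- `swap P p q` : exchange the outgoing arcs of the places `p` and `q`. -/
noncomputable def swap (P : RawProc N) (p q : N.Amb) : RawProc N :=
  { P with Fst := fun x t => if x = p then P.Fst q t else if x = q then P.Fst p t else P.Fst x t }

end RawProc

/-- The conditions making a `RawProc` a GR-process of the net `N`. -/
structure IsProc (N : Net) (P : RawProc N) : Prop where
  fst_dom : ∀ x t, 0 < P.Fst x t → x ∈ P.pl ∧ t ∈ P.tr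
  fts_dom : ∀ t x, 0 < P.Fts t x → x ∈ P.pl ∧ t ∈ P.tr
  pre_unique : ∀ x t t', 0 < P.Fts t x → 0 < P.Fts t' x → t = t'
  pre_le_one : ∀ t x, P.Fts t x ≤ 1
  post_unique : ∀ x t t', 0 < P.Fst x t → 0 < P.Fst x t' → t = t'
  post_le_one : ∀ x t, P.Fst x t ≤ 1
  acyclic : ∀ z, ¬ P.causal z z
  finite_past : ∀ u ∈ P.tr, {t : N.Amb | P.causal (Sum.inr t) (Sum.inr u)}.Finite
  init_fin : ∀ s : N.S, {x | x ∈ P.init ∧ P.piS x = s}.Finite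
  init_marking : ∀ s : N.S, N.M0 s = {x | x ∈ P.init ∧ P.piS x = s}.ncard
  pre_fin : ∀ t ∈ P.tr, {x | 0 < P.Fst x t}.Finite
  post_fin : ∀ t ∈ P.tr, {x | 0 < P.Fts t x}.Finite
  pre_match : ∀ t ∈ P.tr, ∀ s : N.S, N.pre (P.piT t) s = ∑ᶠ x ∈ {x | P.piS x = s}, P.Fst x t
  post_match : ∀ t ∈ P.tr, ∀ s : N.S, N.post (P.piT t) s = ∑ᶠ x ∈ {x | P.piS x = s}, P.Fts t x

/-- `ProcPrefix N Q P` : `Q ≤ P`, i.e. `Q` is a prefix of the process `P`. -/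
def ProcPrefix (N : Net) (Q P : RawProc N) : Prop :=
  Q.pl ⊆ P.pl ∧ Q.tr ⊆ P.tr ∧
  (∀ x ∈ Q.pl, ∀ t ∈ Q.tr, Q.Fst x t = P.Fst x t ∧ Q.Fts t x = P.Fts t x) ∧
  (∀ x ∈ Q.pl, Q.piS x = P.piS x) ∧ (∀ t ∈ Q.tr, Q.piT t = P.piT t) ∧
  Q.init = P.init

/-- Isomorphism of processes: a bijection between places and between transitions
respecting the flow, the initial marking and the process mappings. -/
def Iso (N : Net) (P Q : RawProc N) : Prop :=
  ∃ fp ft : N.Amb → N.Amb,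
    Set.BijOn fp P.pl Q.pl ∧ Set.BijOn ft P.tr Q.tr ∧
    (∀ x ∈ P.pl, ∀ t ∈ P.tr,
      Q.Fst (fp x) (ft t) = P.Fst x t ∧ Q.Fts (ft t) (fp x) = P.Fts t x) ∧
    (∀ x ∈ P.pl, (x ∈ P.init ↔ fp x ∈ Q.init)) ∧
    (∀ x ∈ P.pl, Q.piS (fp x) = P.piS x) ∧ (∀ t ∈ P.tr, Q.piT (ft t) = P.piT t)

/-- `p` and `q` are causally unordered places with the same image, so they may be swapped. -/
def Swappable {N : Net} (P : RawProc N) (p q : N.Amb) : Prop :=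
  p ∈ P.pl ∧ q ∈ P.pl ∧ P.piS p = P.piS q ∧
  ¬ P.causal (Sum.inl p) (Sum.inl q) ∧ ¬ P.causal (Sum.inl q) (Sum.inl p)

/-- `P ∼__S Q` : `Q` is obtained from `P` by a single swap. -/
def SwapRel (N : Net) (P Q : RawProc N) : Prop :=
  ∃ p q, Swappable P p q ∧ Q = P.swap p q

/-- `P ≡₁ Q` : one-step swapping equivalence of GR-processes (swap followed by isomorphism). -/
def OneSwap (N : Net) (P Q : RawProc N) : Prop :=
  IsProc N P ∧ IsProc N Q ∧ ∃ p q, Swappable P p q ∧ Iso N (P.swap p q) Q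

/-- `P ≡₁* Q` : the reflexive-transitive closure of one-step swapping equivalence. -/
def SwapEqv (N : Net) : RawProc N → RawProc N → Prop :=
  Relation.ReflTransGen (OneSwap N)

/-- `P —a→ Q` : the process `Q` extends `P` by exactly one transition, labelled `a`. -/
def StepExt (N : Net) (P Q : RawProc N) (a : N.T) : Prop :=
  ProcPrefix N P Q ∧ ∃ t, t ∉ P.tr ∧ Q.tr = insert t P.tr ∧ Q.piT t = a

/-- `P ⊑₁^∞ Q` : every finite prefix `P''` of `P` satisfies
`P'' ≤ P' ≡₁* Q' ≤ Q` for some finite GR-processes `P'`, `Q'`. -/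
def SwapLe (N : Net) (P Q : RawProc N) : Prop :=
  ∀ P'' : RawProc N, IsProc N P'' → P''.FiniteP → ProcPrefix N P'' P →
    ∃ P' Q' : RawProc N, IsProc N P' ∧ P'.FiniteP ∧ IsProc N Q' ∧ Q'.FiniteP ∧
      ProcPrefix N P'' P' ∧ SwapEqv N P' Q' ∧ ProcPrefix N Q' Q

/-- `BDapprox N P` : the smallest set of finite GR-processes containing all finite
prefixes of `P` and closed under `≡₁` and under taking prefixes. -/
inductive BDapprox (N : Net) (P : RawProc N) : RawProc N → Prop
  | base (Q : RawProc N) : IsProc N Q → Q.FiniteP → ProcPrefix N Q P → BDapprox N P Q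
  | swapc (Q R : RawProc N) :
      BDapprox N P R → IsProc N Q → Q.FiniteP → OneSwap N Q R → BDapprox N P Q
  | prefc (Q R : RawProc N) :
      BDapprox N P R → IsProc N Q → Q.FiniteP → ProcPrefix N Q R → BDapprox N P Q


section Helpers

theorem finsum_ncard {α : Type*} (f : α → ℕ) (hf : ∀ x, f x ≤ 1) (p : Set α) :
    ∑ᶠ x ∈ p, f x = {x | x ∈ p ∧ 0 < f x}.ncard := by
  rw [← finsum_mem_inter_support]
  have : p ∩ Function.support f = {x | x ∈ p ∧ 0 < f x} := by
    ext x; simp [Nat.pos_iff_ne_zero]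
  rw [this, ← finsum_one]
  apply finsum_mem_congr rfl
  rintro x ⟨_, hx⟩
  have := hf x
  omega

open Classical in
/-- Extension of a process by one transition. -/
noncomputable def procExt {N : Net} (P : RawProc N) (t : N.Amb) (C D : Set N.Amb)
    (l : N.Amb → N.S) (k : N.Amb → N.T) : RawProc N where
  pl := P.pl ∪ D
  tr := insert t P.tr
  Fst := fun x u => if u = t then (if x ∈ C then 1 else 0) else P.Fst x u
  Fts := fun u x => if u = t then (if x ∈ D then 1 else 0) else P.Fts u x
  piS := fun x => if x ∈ P.pl then P.piS x else l x
  piT := fun u => if u ∈ P.tr then P.piT u else k u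

structure GoodExt {N : Net} (P : RawProc N) (t : N.Amb) (C D : Set N.Amb)
    (l : N.Amb → N.S) (k : N.Amb → N.T) : Prop where
  fresh : t ∉ P.tr
  sub : C ⊆ P.ends
  finC : C.Finite
  finD : D.Finite
  disj : ∀ x ∈ D, x ∉ P.pl
  cPre : ∀ s, N.pre (k t) s = {x | x ∈ C ∧ P.piS x = s}.ncard
  cPost : ∀ s, N.post (k t) s = {x | x ∈ D ∧ l x = s}.ncard

variable {N : Net}

theorem IsProc.fst_zero {P : RawProc N} (hP : IsProc N P) {x t : N.Amb} (h : x ∉ P.pl ∨ t ∉ P.tr) :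
    P.Fst x t = 0 := by
  by_contra hc
  have := hP.fst_dom x t (Nat.pos_of_ne_zero hc)
  tauto

theorem IsProc.fts_zero {P : RawProc N} (hP : IsProc N P) {x t : N.Amb} (h : x ∉ P.pl ∨ t ∉ P.tr) :
    P.Fts t x = 0 := by
  by_contra hc
  have := hP.fts_dom t x (Nat.pos_of_ne_zero hc)
  tauto

theorem procExt_init {P : RawProc N} (hP : IsProc N P) {t : N.Amb} {C D : Set N.Amb}
    {l : N.Amb → N.S} {k : N.Amb → N.T} (h : GoodExt P t C D l k) :
    (procExt P t C D l k).init = P.init := by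
  ext x
  simp only [RawProc.init, procExt, Set.mem_ofPred_eq, Set.mem_union]
  constructor
  · rintro ⟨h1, h2⟩
    have hD : x ∉ D := by
      intro hx
      have := h2 t
      simp [hx] at this
    refine ⟨by tauto, fun u => ?_⟩
    by_cases hu : u = t
    · subst hu; exact hP.fts_zero (Or.inr h.fresh)
    · have := h2 u
      simpa [hu] using this
  · rintro ⟨h1, h2⟩
    refine ⟨Or.inl h1, fun u => ?_⟩
    have hD : x ∉ D := fun hx => h.disj x hx h1
    simp [hD, h2]

theorem procExt_ends {P : RawProc N} (hP : IsProc N P) {t : N.Amb} {C D : Set N.Amb}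
    {l : N.Amb → N.S} {k : N.Amb → N.T} (h : GoodExt P t C D l k) :
    (procExt P t C D l k).ends = (P.ends \ C) ∪ D := by
  ext x
  simp only [RawProc.ends, procExt, Set.mem_ofPred_eq, Set.mem_union, Set.mem_sdiff]
  constructor
  · rintro ⟨h1, h2⟩
    have hC : x ∉ C := by
      intro hx
      have := h2 t
      simp [hx] at this
    rcases h1 with h1 | h1
    · left
      refine ⟨⟨h1, fun u => ?_⟩, hC⟩
      by_cases hu : u = t
      · subst hu; exact hP.fst_zero (Or.inr h.fresh)
      · have := h2 u
        simpa [hu] using this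
    · exact Or.inr h1
  · rintro (⟨⟨h1, h2⟩, h3⟩ | h1)
    · exact ⟨Or.inl h1, fun u => by simp [h3, h2]⟩
    · refine ⟨Or.inr h1, fun u => ?_⟩
      have hC : x ∉ C := fun hx => h.disj x h1 (h.sub hx).1
      simp [hC, hP.fst_zero (Or.inl (h.disj x h1))]

open Classical in
noncomputable def rk (t : N.Amb) (D : Set N.Amb) : N.Amb ⊕ N.Amb → ℕ
  | Sum.inl x => if x ∈ D then 2 else 0
  | Sum.inr u => if u = t then 1 else 0

theorem procExt_rel {P : RawProc N} (hP : IsProc N P) {t : N.Amb} {C D : Set N.Amb}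
    {l : N.Amb → N.S} {k : N.Amb → N.T} (h : GoodExt P t C D l k) {z w}
    (hzw : (procExt P t C D l k).rel z w) :
    rk t D z < rk t D w ∨ (rk t D z = 0 ∧ rk t D w = 0 ∧ P.rel z w) := by
  rcases z with x | u <;> rcases w with y | v
  · simp [RawProc.rel] at hzw
  · simp only [RawProc.rel, procExt, rk] at hzw ⊢
    by_cases hv : v = t
    · have hx : x ∈ C := by
        by_contra hx
        simp [hv, hx] at hzw
      have hC : x ∉ D := fun hd => h.disj x hd (h.sub hx).1
      simp [hv, hC]
    · simp only [hv, if_false] at hzw ⊢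
      have hC : x ∉ D := fun hd => h.disj x hd (hP.fst_dom _ _ hzw).1
      simp [hC, hzw]
  · simp only [RawProc.rel, procExt, rk] at hzw ⊢
    by_cases hv : u = t
    · have hx : y ∈ D := by
        by_contra hx
        simp [hv, hx] at hzw
      simp [hv, hx]
    · simp only [hv, if_false] at hzw ⊢
      have hC : y ∉ D := fun hd => h.disj y hd (hP.fts_dom _ _ hzw).1
      simp [hC, hzw]
  · simp [RawProc.rel] at hzw

theorem procExt_causal {P : RawProc N} (hP : IsProc N P) {t : N.Amb} {C D : Set N.Amb}
    {l : N.Amb → N.S} {k : N.Amb → N.T} (h : GoodExt P t C D l k) {z w}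
    (hzw : (procExt P t C D l k).causal z w) :
    rk t D z < rk t D w ∨ (rk t D z = 0 ∧ rk t D w = 0 ∧ P.causal z w) := by
  induction hzw with
  | single hr =>
    rcases procExt_rel hP h hr with h1 | ⟨h1, h2, h3⟩
    · exact Or.inl h1
    · exact Or.inr ⟨h1, h2, Relation.TransGen.single h3⟩
  | tail _ hr ih =>
    rcases procExt_rel hP h hr with h1 | ⟨h1, h2, h3⟩
    · left
      rcases ih with h4 | h4 <;> omega
    · rcases ih with h4 | ⟨h4, h5, h6⟩
      · omega
      · exact Or.inr ⟨h4, h2, h6.tail h3⟩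

theorem procExt_piS_C {P : RawProc N} {t : N.Amb} {C D : Set N.Amb}
    {l : N.Amb → N.S} {k : N.Amb → N.T} {x : N.Amb} (hx : x ∈ P.pl) :
    (procExt P t C D l k).piS x = P.piS x := by simp [procExt, hx]

theorem procExt_isProc {P : RawProc N} (hP : IsProc N P) (hf : P.FiniteP)
    {t : N.Amb} {C D : Set N.Amb}
    {l : N.Amb → N.S} {k : N.Amb → N.T} (h : GoodExt P t C D l k) :
    IsProc N (procExt P t C D l k) := by
  have hfst : ∀ x u, 0 < (procExt P t C D l k).Fst x u ↔
      (u = t ∧ x ∈ C) ∨ (u ≠ t ∧ 0 < P.Fst x u) := by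
    intro x u
    simp only [procExt]
    split_ifs <;> simp_all
  have hfts : ∀ u x, 0 < (procExt P t C D l k).Fts u x ↔
      (u = t ∧ x ∈ D) ∨ (u ≠ t ∧ 0 < P.Fts u x) := by
    intro u x
    simp only [procExt]
    split_ifs <;> simp_all
  have hle1 : ∀ u x, (procExt P t C D l k).Fts u x ≤ 1 := by
    intro u x
    simp only [procExt]
    split_ifs <;> simp [hP.pre_le_one]
  have hle2 : ∀ x u, (procExt P t C D l k).Fst x u ≤ 1 := by
    intro u x
    simp only [procExt]
    split_ifs <;> simp [hP.post_le_one]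
  have hfd : ∀ x u, 0 < (procExt P t C D l k).Fst x u →
      x ∈ (procExt P t C D l k).pl ∧ u ∈ (procExt P t C D l k).tr := by
    intro x u hx
    rcases (hfst x u).1 hx with ⟨h1, h2⟩ | ⟨h1, h2⟩
    · exact ⟨Or.inl (h.sub h2).1, Or.inl h1⟩
    · have := hP.fst_dom _ _ h2
      exact ⟨Or.inl this.1, Or.inr this.2⟩
  have hfd' : ∀ u x, 0 < (procExt P t C D l k).Fts u x →
      x ∈ (procExt P t C D l k).pl ∧ u ∈ (procExt P t C D l k).tr := by
    intro u x hx
    rcases (hfts u x).1 hx with ⟨h1, h2⟩ | ⟨h1, h2⟩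
    · exact ⟨Or.inr h2, Or.inl h1⟩
    · have := hP.fts_dom _ _ h2
      exact ⟨Or.inl this.1, Or.inr this.2⟩
  have hinit : ∀ s, {x | x ∈ (procExt P t C D l k).init ∧ (procExt P t C D l k).piS x = s}
      = {x | x ∈ P.init ∧ P.piS x = s} := by
    intro s
    rw [procExt_init hP h]
    ext x
    simp only [Set.mem_ofPred_eq]
    constructor <;> rintro ⟨h1, h2⟩ <;> refine ⟨h1, ?_⟩
    · rwa [procExt_piS_C h1.1] at h2
    · rwa [procExt_piS_C h1.1]
  refine ⟨hfd, hfd', ?_, hle1, ?_, hle2, ?_, ?_, ?_, ?_, ?_, ?_, ?_, ?_⟩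
  · intro x u v hu hv
    rw [hfts] at hu hv
    rcases hu with ⟨h1, h2⟩ | ⟨h1, h2⟩ <;> rcases hv with ⟨h3, h4⟩ | ⟨h3, h4⟩
    · rw [h1, h3]
    · exact absurd (hP.fts_dom _ _ h4).1 (h.disj x h2)
    · exact absurd (hP.fts_dom _ _ h2).1 (h.disj x h4)
    · exact hP.pre_unique x u v h2 h4
  · intro x u v hu hv
    rw [hfst] at hu hv
    rcases hu with ⟨h1, h2⟩ | ⟨h1, h2⟩ <;> rcases hv with ⟨h3, h4⟩ | ⟨h3, h4⟩
    · rw [h1, h3]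
    · have := (h.sub h2).2 v; omega
    · have := (h.sub h4).2 u; omega
    · exact hP.post_unique x u v h2 h4
  · intro z hz
    rcases procExt_causal hP h hz with h1 | ⟨_, _, h1⟩
    · omega
    · exact hP.acyclic z h1
  · intro u _
    refine Set.Finite.subset (s := insert t P.tr) (Set.Finite.insert t hf) ?_
    intro v hv
    rcases Relation.TransGen.head'_iff.1 hv with ⟨c, hc, _⟩
    rcases c with c | c
    · exact (hfd' _ _ hc).2
    · exact hc.elim
  · intro s; rw [hinit]; exact hP.init_fin s
  · intro s; rw [hinit]; exact hP.init_marking s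
  · intro u hu
    by_cases hut : u = t
    · refine h.finC.subset ?_
      intro x hx
      rcases (hfst _ _).1 hx with h1 | h1
      · exact h1.2
      · exact absurd hut h1.1
    · refine (hP.pre_fin u (hu.resolve_left hut)).subset ?_
      intro x hx
      rcases (hfst _ _).1 hx with h1 | h1
      · exact absurd h1.1 hut
      · exact h1.2
  · intro u hu
    by_cases hut : u = t
    · refine h.finD.subset ?_
      intro x hx
      rcases (hfts _ _).1 hx with h1 | h1
      · exact h1.2
      · exact absurd hut h1.1
    · refine (hP.post_fin u (hu.resolve_left hut)).subset ?_
      intro x hx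
      rcases (hfts _ _).1 hx with h1 | h1
      · exact absurd h1.1 hut
      · exact h1.2
  · intro u hu s
    rw [finsum_ncard _ (fun x => hle2 x u)]
    by_cases hut : u = t
    · have : (procExt P t C D l k).piT u = k t := by simp [procExt, hut, h.fresh]
      rw [this, h.cPre]
      congr 1
      ext x
      simp only [Set.mem_ofPred_eq, hfst]
      constructor
      · rintro ⟨h1, h2⟩
        exact ⟨by rwa [procExt_piS_C (h.sub h1).1], Or.inl ⟨hut, h1⟩⟩
      · rintro ⟨h1, h2 | h2⟩
        · refine ⟨h2.2, ?_⟩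
          rwa [procExt_piS_C (h.sub h2.2).1] at h1
        · exact absurd hut h2.1
    · have hu' : u ∈ P.tr := hu.resolve_left hut
      have : (procExt P t C D l k).piT u = P.piT u := by simp [procExt, hu']
      rw [this, hP.pre_match u hu' s, finsum_ncard _ (fun x => hP.post_le_one x u)]
      congr 1
      ext x
      simp only [Set.mem_ofPred_eq, hfst]
      constructor
      · rintro ⟨h1, h2⟩
        exact ⟨by rwa [procExt_piS_C (hP.fst_dom _ _ h2).1], Or.inr ⟨hut, h2⟩⟩
      · rintro ⟨h1, h2 | h2⟩
        · exact absurd h2.1 hut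
        · refine ⟨?_, h2.2⟩
          rwa [procExt_piS_C (hP.fst_dom _ _ h2.2).1] at h1
  · intro u hu s
    rw [finsum_ncard _ (fun x => hle1 u x)]
    by_cases hut : u = t
    · have : (procExt P t C D l k).piT u = k t := by simp [procExt, hut, h.fresh]
      rw [this, h.cPost]
      congr 1
      ext x
      simp only [Set.mem_ofPred_eq, hfts]
      constructor
      · rintro ⟨h1, h2⟩
        exact ⟨by simpa [procExt, h.disj x h1] using h2, Or.inl ⟨hut, h1⟩⟩
      · rintro ⟨h1, h2 | h2⟩
        · refine ⟨h2.2, ?_⟩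
          simpa [procExt, h.disj x h2.2] using h1
        · exact absurd hut h2.1
    · have hu' : u ∈ P.tr := hu.resolve_left hut
      have : (procExt P t C D l k).piT u = P.piT u := by simp [procExt, hu']
      rw [this, hP.post_match u hu' s, finsum_ncard _ (fun x => hP.pre_le_one u x)]
      congr 1
      ext x
      simp only [Set.mem_ofPred_eq, hfts]
      constructor
      · rintro ⟨h1, h2⟩
        exact ⟨by rwa [procExt_piS_C (hP.fts_dom _ _ h2).1], Or.inr ⟨hut, h2⟩⟩
      · rintro ⟨h1, h2 | h2⟩
        · exact absurd h2.1 hut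
        · refine ⟨?_, h2.2⟩
          rwa [procExt_piS_C (hP.fts_dom _ _ h2.2).1] at h1

theorem procExt_finite {P : RawProc N} (hf : P.FiniteP)
    {t : N.Amb} {C D : Set N.Amb} {l : N.Amb → N.S} {k : N.Amb → N.T} :
    (procExt P t C D l k).FiniteP := Set.Finite.insert t hf

theorem procExt_stepExt {P : RawProc N} (hP : IsProc N P)
    {t : N.Amb} {C D : Set N.Amb}
    {l : N.Amb → N.S} {k : N.Amb → N.T} (h : GoodExt P t C D l k) :
    StepExt N P (procExt P t C D l k) (k t) := by
  refine ⟨⟨Set.subset_union_left, Set.subset_insert _ _, ?_, ?_, ?_, ?_⟩, t, h.fresh, rfl, ?_⟩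
  · intro x hx u hu
    have : u ≠ t := fun he => h.fresh (he ▸ hu)
    simp [procExt, this]
  · intro x hx; simp [procExt, hx]
  · intro x hx; simp [procExt, hx]
  · exact (procExt_init hP h).symm
  · simp [procExt, h.fresh]

open Classical in
theorem stepExt_eq {P P' : RawProc N} (hP : IsProc N P) (hP' : IsProc N P') {a : N.T}
    (h : StepExt N P P' a) : ∃ t C D l k, GoodExt P t C D l k ∧ k t = a ∧
      P' = procExt P t C D l k := by
  obtain ⟨⟨hpl, htr, hF, hS, hT, hinit⟩, t, ht, htr', hta⟩ := h
  have htt : t ∈ P'.tr := by rw [htr']; exact Set.mem_insert _ _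
  have hpost : ∀ u ∈ P.tr, ∀ x, 0 < P'.Fts u x → x ∈ P.pl := by
    intro u hu x hx
    have e1 := hP.post_match u hu (P'.piS x)
    have e2 := hP'.post_match u (htr hu) (P'.piS x)
    rw [finsum_ncard _ (fun x => hP.pre_le_one u x)] at e1
    rw [finsum_ncard _ (fun x => hP'.pre_le_one u x), ← hT u hu, e1] at e2
    have := Set.eq_of_subset_of_ncard_le (s := {y | y ∈ {y | P.piS y = P'.piS x} ∧ 0 < P.Fts u y})
      (t := {y | y ∈ {y | P'.piS y = P'.piS x} ∧ 0 < P'.Fts u y}) ?_ e2.ge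
        ((hP'.post_fin u (htr hu)).subset fun y hy => hy.2)
    · have hx' : x ∈ {y | y ∈ {y | P'.piS y = P'.piS x} ∧ 0 < P'.Fts u y} := ⟨rfl, hx⟩
      rw [← this] at hx'
      exact (hP.fts_dom _ _ hx'.2).1
    · rintro y ⟨h1, h2⟩
      have hy := (hP.fts_dom _ _ h2).1
      refine ⟨?_, ?_⟩
      · simpa [← hS y hy] using h1
      · rw [← (hF y hy u hu).2]; exact h2
  have hpre : ∀ u ∈ P.tr, ∀ x, 0 < P'.Fst x u → x ∈ P.pl := by
    intro u hu x hx
    have e1 := hP.pre_match u hu (P'.piS x)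
    have e2 := hP'.pre_match u (htr hu) (P'.piS x)
    rw [finsum_ncard _ (fun x => hP.post_le_one x u)] at e1
    rw [finsum_ncard _ (fun x => hP'.post_le_one x u), ← hT u hu, e1] at e2
    have := Set.eq_of_subset_of_ncard_le (s := {y | y ∈ {y | P.piS y = P'.piS x} ∧ 0 < P.Fst y u})
      (t := {y | y ∈ {y | P'.piS y = P'.piS x} ∧ 0 < P'.Fst y u}) ?_ e2.ge
        ((hP'.pre_fin u (htr hu)).subset fun y hy => hy.2)
    · have hx' : x ∈ {y | y ∈ {y | P'.piS y = P'.piS x} ∧ 0 < P'.Fst y u} := ⟨rfl, hx⟩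
      rw [← this] at hx'
      exact (hP.fst_dom _ _ hx'.2).1
    · rintro y ⟨h1, h2⟩
      have hy := (hP.fst_dom _ _ h2).1
      refine ⟨?_, ?_⟩
      · simpa [← hS y hy] using h1
      · rw [← (hF y hy u hu).1]; exact h2
  have hnew : ∀ x ∈ P'.pl, x ∉ P.pl → 0 < P'.Fts t x := by
    intro x hx hxP
    have : x ∉ P'.init := by rw [← hinit]; exact fun hh => hxP hh.1
    have : ∃ u, P'.Fts u x ≠ 0 := by
      by_contra hc
      push Not at hc
      exact this ⟨hx, hc⟩
    obtain ⟨u, hu⟩ := this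
    have hu := Nat.pos_of_ne_zero hu
    have h3 := (hP'.fts_dom _ _ hu).2
    rw [htr'] at h3
    rcases h3 with rfl | h3
    · exact hu
    · exact absurd (hpost u h3 x hu) hxP
  have hDd : ∀ x, 0 < P'.Fts t x → x ∉ P.pl := by
    intro x hx hxP
    have : x ∉ P.init := by
      rw [hinit]; intro hh
      have := hh.2 t
      omega
    have : ∃ u, P.Fts u x ≠ 0 := by
      by_contra hc
      push Not at hc
      exact this ⟨hxP, hc⟩
    obtain ⟨u, hu⟩ := this
    have hu := Nat.pos_of_ne_zero hu
    have h3 := (hP.fts_dom _ _ hu).2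
    have h4 := (hF x hxP u h3).2
    have := hP'.pre_unique x u t (h4 ▸ hu) hx
    exact ht (this ▸ h3)
  have hC : ∀ x, 0 < P'.Fst x t → x ∈ P.ends := by
    intro x hx
    have hxP : x ∈ P.pl := by
      by_contra hxP
      have := hnew x (hP'.fst_dom _ _ hx).1 hxP
      refine hP'.acyclic (Sum.inr t) ?_
      refine Relation.TransGen.tail (b := Sum.inl x) (Relation.TransGen.single ?_) ?_
      · exact this
      · exact hx
    refine ⟨hxP, fun u => ?_⟩
    by_contra hu
    have hu := Nat.pos_of_ne_zero hu
    have h3 := (hP.fst_dom _ _ hu).2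
    have h4 := (hF x hxP u h3).1
    have := hP'.post_unique x u t (h4 ▸ hu) hx
    exact ht (this ▸ h3)
  refine ⟨t, {x | 0 < P'.Fst x t}, {x | 0 < P'.Fts t x}, P'.piS, P'.piT, ⟨ht, hC,
    hP'.pre_fin t htt, hP'.post_fin t htt, hDd, ?_, ?_⟩, hta, ?_⟩
  · intro s
    rw [hP'.pre_match t htt s, finsum_ncard _ (fun x => hP'.post_le_one x t)]
    congr 1
    ext x
    simp only [Set.mem_ofPred_eq]
    constructor
    · rintro ⟨h1, h2⟩
      exact ⟨h2, by rw [hS x (hC x h2).1]; exact h1⟩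
    · rintro ⟨h1, h2⟩
      exact ⟨by rw [← hS x (hC x h1).1]; exact h2, h1⟩
  · intro s
    rw [hP'.post_match t htt s, finsum_ncard _ (fun x => hP'.pre_le_one t x)]
    congr 1
    ext x
    simp only [Set.mem_ofPred_eq]
    tauto
  · have e1 : P'.pl = P.pl ∪ {x | 0 < P'.Fts t x} := by
      ext x
      constructor
      · intro hx
        by_cases hxP : x ∈ P.pl
        · exact Or.inl hxP
        · exact Or.inr (hnew x hx hxP)
      · rintro (hx | hx)
        · exact hpl hx
        · exact (hP'.fts_dom _ _ hx).1
    have e2 : ∀ x u, P'.Fst x u = (procExt P t {x | 0 < P'.Fst x t} {x | 0 < P'.Fts t x}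
        P'.piS P'.piT).Fst x u := by
      intro x u
      simp only [procExt, Set.mem_ofPred_eq]
      split_ifs with h1 h2
      · have := hP'.post_le_one x t
        rw [h1]; omega
      · rw [h1]; omega
      · by_cases hu : u ∈ P.tr
        · by_cases hx : x ∈ P.pl
          · exact (hF x hx u hu).1.symm
          · rw [hP.fst_zero (Or.inl hx)]
            by_contra hc
            exact hx (hpre u hu x (Nat.pos_of_ne_zero hc))
        · rw [hP.fst_zero (Or.inr hu), hP'.fst_zero (Or.inr _)]
          rw [htr']
          rintro (h | h)
          · exact h1 h
          · exact hu h
    have e3 : ∀ u x, P'.Fts u x = (procExt P t {x | 0 < P'.Fst x t} {x | 0 < P'.Fts t x}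
        P'.piS P'.piT).Fts u x := by
      intro u x
      simp only [procExt, Set.mem_ofPred_eq]
      split_ifs with h1 h2
      · have := hP'.pre_le_one t x
        rw [h1]; omega
      · rw [h1]; omega
      · by_cases hu : u ∈ P.tr
        · by_cases hx : x ∈ P.pl
          · exact (hF x hx u hu).2.symm
          · rw [hP.fts_zero (Or.inl hx)]
            by_contra hc
            exact hx (hpost u hu x (Nat.pos_of_ne_zero hc))
        · rw [hP.fts_zero (Or.inr hu), hP'.fts_zero (Or.inr _)]
          rw [htr']
          rintro (h | h)
          · exact h1 h
          · exact hu h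
    have e4 : ∀ x, P'.piS x = if x ∈ P.pl then P.piS x else P'.piS x := by
      intro x
      split_ifs with h1
      · exact (hS x h1).symm
      · rfl
    have e5 : ∀ x, P'.piT x = if x ∈ P.tr then P.piT x else P'.piT x := by
      intro x
      split_ifs with h1
      · exact (hT x h1).symm
      · rfl
    have e2' := funext fun x => funext (e2 x)
    have e3' := funext fun x => funext (e3 x)
    have e4' := funext e4
    have e5' := funext e5
    cases P' with
    | mk pl tr Fst Fts piS piT =>
      simp only [procExt, RawProc.mk.injEq] at *
      refine ⟨e1, htr', e2', e3', ?_, ?_⟩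
      · exact e4'
      · exact e5'

/-- Finite processes have finitely many end places above each place. -/
theorem pl_cover {P : RawProc N} (hP : IsProc N P) :
    P.pl ⊆ P.init ∪ ⋃ t ∈ P.tr, {x | 0 < P.Fts t x} := by
  intro x hx
  by_cases h : ∀ t, P.Fts t x = 0
  · exact Or.inl ⟨hx, h⟩
  · push Not at h
    obtain ⟨t, ht⟩ := h
    have ht := Nat.pos_of_ne_zero ht
    right
    simp only [Set.mem_iUnion]
    exact ⟨t, (hP.fts_dom _ _ ht).2, ht⟩

theorem posts_finite {P : RawProc N} (hP : IsProc N P) (hf : P.FiniteP) :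
    (⋃ t ∈ P.tr, {x | 0 < P.Fts t x}).Finite :=
  Set.Finite.biUnion hf fun t ht => hP.post_fin t ht

theorem ends_fin {P : RawProc N} (hP : IsProc N P) (hf : P.FiniteP) (s : N.S) :
    {x | x ∈ P.ends ∧ P.piS x = s}.Finite := by
  refine ((hP.init_fin s).union (posts_finite hP hf)).subset ?_
  rintro x ⟨h1, h2⟩
  rcases pl_cover hP h1.1 with h | h
  · exact Or.inl ⟨h, h2⟩
  · exact Or.inr h

theorem compl_infinite {P : RawProc N} (hP : IsProc N P) (hf : P.FiniteP) :
    (P.plᶜ).Infinite := by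
  intro hfin
  have h1 : (Set.univ : Set N.Amb) ⊆ (⋃ s : N.S, {x | x ∈ P.init ∧ P.piS x = s}) ∪
      ((⋃ t ∈ P.tr, {x | 0 < P.Fts t x}) ∪ P.plᶜ) := by
    intro x _
    by_cases hx : x ∈ P.pl
    · rcases pl_cover hP hx with h | h
      · exact Or.inl (Set.mem_iUnion.2 ⟨P.piS x, h, rfl⟩)
      · exact Or.inr (Or.inl h)
    · exact Or.inr (Or.inr hx)
  have hfin2 := (posts_finite hP hf).union hfin
  have hX : Cardinal.aleph0 ≤ Cardinal.mk (N.S ⊕ N.T ⊕ ℕ) := Cardinal.aleph0_le_mk _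
  have hS : Cardinal.mk N.S ≤ Cardinal.mk (N.S ⊕ N.T ⊕ ℕ) :=
    Cardinal.mk_le_of_injective Sum.inl_injective
  have h2 : Cardinal.mk N.Amb = 2 ^ Cardinal.mk (N.S ⊕ N.T ⊕ ℕ) := Cardinal.mk_set
  have h3 : Cardinal.mk N.Amb ≤ Cardinal.mk (N.S ⊕ N.T ⊕ ℕ) := by
    rw [← Cardinal.mk_univ]
    refine (Cardinal.mk_le_mk_of_subset h1).trans ((Cardinal.mk_union_le _ _).trans ?_)
    refine Cardinal.add_le_of_le hX ?_ ?_
    · refine (Cardinal.mk_iUnion_le _).trans ?_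
      refine Cardinal.mul_le_of_le hX hS ?_
      refine ciSup_le' fun s => ?_
      exact (hP.init_fin s).countable.le_aleph0.trans hX
    · exact hfin2.countable.le_aleph0.trans hX
  rw [h2] at h3
  exact absurd (Cardinal.cantor _) h3.not_gt

theorem exists_fresh_places {P : RawProc N} (hP : IsProc N P) (hf : P.FiniteP)
    {E : Set N.Amb} (hE : E.Finite) :
    ∃ g : N.Amb → N.Amb, (∀ x ∈ E, g x ∉ P.pl) ∧ Set.InjOn g E := by
  have : Nonempty N.Amb := ⟨(∅ : Set (N.S ⊕ N.T ⊕ ℕ))⟩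
  obtain ⟨f, h1, h2⟩ := hE.exists_injOn_of_encard_le (t := P.plᶜ)
    (by rw [(compl_infinite hP hf).encard_eq]; exact le_top)
  exact ⟨f, fun x hx => h1 hx, h2⟩

theorem exists_fresh_tr {P : RawProc N} (hP : IsProc N P) (hf : P.FiniteP) :
    ∃ t, t ∉ P.tr := by
  have : Infinite N.Amb := ⟨fun hfin => compl_infinite hP hf (Set.toFinite _)⟩
  exact Set.Finite.exists_notMem hf

theorem enabled_single (M : N.S → ℕ) (a : N.T) :
    N.Enabled M (Finsupp.single a 1) ↔ ∀ s, N.pre a s ≤ M s := by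
  simp [Net.Enabled, Net.preStep]

theorem enabled_pair (M : N.S → ℕ) (a b : N.T) :
    N.Enabled M (Finsupp.single a 1 + Finsupp.single b 1) ↔
      ∀ s, N.pre a s + N.pre b s ≤ M s := by
  have : ∀ s, N.preStep (Finsupp.single a 1 + Finsupp.single b 1) s = N.pre a s + N.pre b s := by
    intro s
    unfold Net.preStep
    rw [Finsupp.sum_add_index' (by simp) (by intros; ring)]
    simp
  simp [Net.Enabled, this]

theorem good_enabled {P : RawProc N} (hP : IsProc N P) (hf : P.FiniteP)
    {t : N.Amb} {C D : Set N.Amb}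
    {l : N.Amb → N.S} {k : N.Amb → N.T} (h : GoodExt P t C D l k) (s : N.S) :
    N.pre (k t) s ≤ P.endMark s := by
  rw [h.cPre]
  refine Set.ncard_le_ncard ?_ (ends_fin hP hf s)
  rintro x ⟨h1, h2⟩
  exact ⟨h.sub h1, h2⟩

theorem good_fire {P : RawProc N} (hP : IsProc N P) (hf : P.FiniteP)
    {t : N.Amb} {C D : Set N.Amb}
    {l : N.Amb → N.S} {k : N.Amb → N.T} (h : GoodExt P t C D l k) :
    N.Fire P.endMark (k t) (procExt P t C D l k).endMark := by
  refine ⟨by simp, (enabled_single _ _).2 (good_enabled hP hf h), fun s => ?_⟩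
  have e : {x | x ∈ (procExt P t C D l k).ends ∧ (procExt P t C D l k).piS x = s} =
      ({x | x ∈ P.ends ∧ P.piS x = s} \ {x | x ∈ C ∧ P.piS x = s}) ∪ {x | x ∈ D ∧ l x = s} := by
    rw [procExt_ends hP h]
    ext x
    simp only [Set.mem_ofPred_eq, Set.mem_union, Set.mem_sdiff]
    by_cases hx : x ∈ P.pl
    · rw [procExt_piS_C hx]
      have : x ∉ D := fun hd => h.disj x hd hx
      tauto
    · have h1 : x ∉ P.ends := fun hh => hx hh.1
      simp [procExt, hx, h1]
  have hsub : {x | x ∈ C ∧ P.piS x = s} ⊆ {x | x ∈ P.ends ∧ P.piS x = s} :=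
    fun x hx => ⟨h.sub hx.1, hx.2⟩
  show Set.ncard _ = _
  rw [e, Set.ncard_union_eq ?_ ((ends_fin hP hf s).subset Set.sdiff_subset)
    (h.finD.subset fun x hx => hx.1), Set.ncard_sdiff hsub (h.finC.subset fun x hx => hx.1), ← h.cPre,
    ← h.cPost]
  · simp [Net.preStep, Net.postStep, RawProc.endMark]
  · rw [Set.disjoint_left]
    rintro x ⟨h1, _⟩ h2
    exact h.disj x h2.1 h1.1.1

open Classical in
/-- Removing a transition together with its postplaces. -/
noncomputable def rmTr (P : RawProc N) (t : N.Amb) : RawProc N where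
  pl := P.pl \ {x | 0 < P.Fts t x}
  tr := P.tr \ {t}
  Fst := fun x u => if u = t then 0 else P.Fst x u
  Fts := fun u x => if u = t then 0 else P.Fts u x
  piS := P.piS
  piT := P.piT

theorem rmTr_init (P : RawProc N) (t : N.Amb) : (rmTr P t).init = P.init := by
  ext x
  simp only [RawProc.init, rmTr, Set.mem_ofPred_eq, Set.mem_sdiff]
  constructor
  · rintro ⟨⟨h1, h2⟩, h3⟩
    refine ⟨h1, fun u => ?_⟩
    by_cases hu : u = t
    · rw [hu]; omega
    · simpa [hu] using h3 u
  · rintro ⟨h1, h2⟩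
    simp [h1, h2]

theorem rmTr_isProc {P : RawProc N} (hP : IsProc N P) {t : N.Amb}
    (hmax : ∀ u, ¬ P.causal (Sum.inr t) (Sum.inr u)) : IsProc N (rmTr P t) := by
  have hfst : ∀ x u, 0 < (rmTr P t).Fst x u ↔ u ≠ t ∧ 0 < P.Fst x u := by
    intro x u
    simp only [rmTr]
    split_ifs <;> simp_all
  have hfts : ∀ u x, 0 < (rmTr P t).Fts u x ↔ u ≠ t ∧ 0 < P.Fts u x := by
    intro x u
    simp only [rmTr]
    split_ifs <;> simp_all
  have hrel : ∀ z w, (rmTr P t).rel z w → P.rel z w := by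
    intro z w h
    rcases z with x | u <;> rcases w with y | v
    · exact h
    · exact ((hfst _ _).1 h).2
    · exact ((hfts _ _).1 h).2
    · exact h
  have hcau : ∀ z w, (rmTr P t).causal z w → P.causal z w := fun z w h =>
    Relation.TransGen.mono hrel z w h
  refine ⟨?_, ?_, ?_, ?_, ?_, ?_, ?_, ?_, ?_, ?_, ?_, ?_, ?_, ?_⟩
  · intro x u h
    obtain ⟨h1, h2⟩ := (hfst _ _).1 h
    have := hP.fst_dom _ _ h2
    refine ⟨⟨this.1, fun h3 => ?_⟩, this.2, h1⟩
    refine hmax u (Relation.TransGen.tail (b := Sum.inl x) (Relation.TransGen.single h3) h2)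
  · intro u x h
    obtain ⟨h1, h2⟩ := (hfts _ _).1 h
    have := hP.fts_dom _ _ h2
    exact ⟨⟨this.1, fun h3 => h1 (hP.pre_unique x u t h2 h3)⟩, this.2, h1⟩
  · intro x u v h1 h2
    exact hP.pre_unique x u v ((hfts _ _).1 h1).2 ((hfts _ _).1 h2).2
  · intro u x
    simp only [rmTr]; split_ifs <;> simp [hP.pre_le_one]
  · intro x u v h1 h2
    exact hP.post_unique x u v ((hfst _ _).1 h1).2 ((hfst _ _).1 h2).2
  · intro u x
    simp only [rmTr]; split_ifs <;> simp [hP.post_le_one]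
  · exact fun z hz => hP.acyclic z (hcau _ _ hz)
  · intro u hu
    exact (hP.finite_past u hu.1).subset fun v hv => hcau _ _ hv
  · intro s; rw [rmTr_init]; exact hP.init_fin s
  · intro s; rw [rmTr_init]; exact hP.init_marking s
  · intro u hu
    exact (hP.pre_fin u hu.1).subset fun x hx => ((hfst _ _).1 hx).2
  · intro u hu
    exact (hP.post_fin u hu.1).subset fun x hx => ((hfts _ _).1 hx).2
  · intro u hu s
    have : u ≠ t := hu.2
    simp only [rmTr, this, if_false]
    exact hP.pre_match u hu.1 s
  · intro u hu s
    have : u ≠ t := hu.2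
    simp only [rmTr, this, if_false]
    exact hP.post_match u hu.1 s

theorem rmTr_stepExt {P : RawProc N} {t : N.Amb} (ht : t ∈ P.tr) :
    StepExt N (rmTr P t) P (P.piT t) := by
  refine ⟨⟨Set.sdiff_subset, Set.sdiff_subset, ?_, fun _ _ => rfl, fun _ _ => rfl, rmTr_init P t⟩,
    t, fun h => h.2 rfl, ?_, rfl⟩
  · intro x _ u hu
    have : u ≠ t := hu.2
    simp [rmTr, this]
  · simp [rmTr, ht]

theorem exists_max {P : RawProc N} (hP : IsProc N P) (hf : P.FiniteP) (hne : P.tr.Nonempty) :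
    ∃ t ∈ P.tr, ∀ u, ¬ P.causal (Sum.inr t) (Sum.inr u) := by
  obtain ⟨t, ht, hmax⟩ := Set.exists_max_image P.tr
    (fun t => {v : N.Amb | P.causal (Sum.inr v) (Sum.inr t)}.ncard) hf hne
  refine ⟨t, ht, fun u hu => ?_⟩
  have hutr : u ∈ P.tr := by
    rcases Relation.TransGen.tail'_iff.1 hu with ⟨c, _, hc⟩
    rcases c with c | c
    · exact (hP.fst_dom _ _ hc).2
    · exact hc.elim
  have := hmax u hutr
  refine absurd this (not_le.2 ?_)
  refine Set.ncard_lt_ncard ?_ (hP.finite_past u hutr)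
  refine ⟨fun v hv => Relation.TransGen.trans hv hu, fun hsub => ?_⟩
  exact hP.acyclic _ (hsub hu)

theorem endMark_reachable : ∀ (n : ℕ) (P : RawProc N), IsProc N P → P.FiniteP →
    P.tr.ncard = n → N.Reachable P.endMark := by
  intro n
  induction n with
  | zero =>
    intro P hP hf hn
    have hempty : P.tr = ∅ := (Set.ncard_eq_zero hf).1 hn
    have : P.endMark = N.M0 := by
      funext s
      rw [hP.init_marking s]
      unfold RawProc.endMark
      have : P.ends = P.init := by
        ext x
        constructor
        · exact fun h => ⟨h.1, fun t => hP.fts_zero (Or.inr (by simp [hempty]))⟩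
        · exact fun h => ⟨h.1, fun t => hP.fst_zero (Or.inr (by simp [hempty]))⟩
      rw [this]
    rw [this]
    exact Relation.ReflTransGen.refl
  | succ n ih =>
    intro P hP hf hn
    obtain ⟨t, ht, hmax⟩ := exists_max hP hf (Set.nonempty_of_ncard_ne_zero (by omega))
    have hR := rmTr_isProc hP hmax
    have hRf : (rmTr P t).FiniteP := Set.Finite.subset hf Set.sdiff_subset
    have hc : (rmTr P t).tr.ncard = n := by
      have := Set.ncard_sdiff_singleton_of_mem ht
      show (P.tr \ {t}).ncard = n
      omega
    obtain ⟨t', C, D, l, k, hg, _, heq⟩ := stepExt_eq hR hP (rmTr_stepExt ht)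
    refine Relation.ReflTransGen.tail (ih _ hR hRf hc) ⟨k t', ?_⟩
    have := good_fire hR hRf hg
    rwa [← heq] at this

theorem iso_refl (P : RawProc N) : Iso N P P :=
  ⟨id, id, Set.bijOn_id _, Set.bijOn_id _, fun _ _ _ _ => ⟨rfl, rfl⟩, fun _ _ => Iff.rfl,
    fun _ _ => rfl, fun _ _ => rfl⟩

open Classical in
theorem swap_self (P : RawProc N) (p : N.Amb) : P.swap p p = P := by
  unfold RawProc.swap
  have : (fun x t => if x = p then P.Fst p t else if x = p then P.Fst p t else P.Fst x t)
      = P.Fst := by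
    funext x t
    split_ifs with h
    · rw [h]
    · rfl
  cases P
  simp_all

theorem oneSwap_of_iso {P Q : RawProc N} (hP : IsProc N P) (hQ : IsProc N Q) (h : Iso N P Q)
    {p : N.Amb} (hp : p ∈ P.pl) : OneSwap N P Q :=
  ⟨hP, hQ, p, p, ⟨hp, hp, rfl, hP.acyclic _, hP.acyclic _⟩, by rwa [swap_self]⟩

/-- Conditions for a double extension. -/
structure Good2 (P : RawProc N) (u t : N.Amb) (B A E F : Set N.Amb)
    (l₁ : N.Amb → N.S) (k₁ : N.Amb → N.T) (l₂ : N.Amb → N.S) (k₂ : N.Amb → N.T) : Prop where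
  g1 : GoodExt P u B E l₁ k₁
  tfresh : t ∉ P.tr
  tu : t ≠ u
  sub : A ⊆ P.ends
  dAB : ∀ x ∈ A, x ∉ B
  finA : A.Finite
  finF : F.Finite
  disjF : ∀ x ∈ F, x ∉ P.pl
  disjFE : ∀ x ∈ F, x ∉ E
  cPre : ∀ s, N.pre (k₂ t) s = {x | x ∈ A ∧ P.piS x = s}.ncard
  cPost : ∀ s, N.post (k₂ t) s = {x | x ∈ F ∧ l₂ x = s}.ncard

theorem Good2.good {P : RawProc N} (hP : IsProc N P) {u t : N.Amb} {B A E F : Set N.Amb}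
    {l₁ : N.Amb → N.S} {k₁ : N.Amb → N.T} {l₂ : N.Amb → N.S} {k₂ : N.Amb → N.T}
    (h : Good2 P u t B A E F l₁ k₁ l₂ k₂) :
    GoodExt (procExt P u B E l₁ k₁) t A F l₂ k₂ := by
  refine ⟨?_, ?_, h.finA, h.finF, ?_, ?_, h.cPost⟩
  · rintro (h1 | h1)
    · exact h.tu h1
    · exact h.tfresh h1
  · rw [procExt_ends hP h.g1]
    exact fun x hx => Or.inl ⟨h.sub hx, h.dAB x hx⟩
  · rintro x hx (h1 | h1)
    · exact h.disjF x hx h1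
    · exact h.disjFE x hx h1
  · intro s
    rw [h.cPre]
    congr 1
    ext x
    simp only [Set.mem_ofPred_eq]
    constructor <;> rintro ⟨h1, h2⟩ <;> refine ⟨h1, ?_⟩
    · rwa [procExt_piS_C (h.sub h1).1]
    · rwa [procExt_piS_C (h.sub h1).1] at h2

theorem count_exchange {π : N.Amb → N.S} {A : Set N.Amb} {p q : N.Amb}
    (hq : q ∈ A) (hp : p ∉ A) (hpq : π p = π q) (s : N.S) :
    {x | x ∈ insert p (A \ {q}) ∧ π x = s}.ncard = {x | x ∈ A ∧ π x = s}.ncard := by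
  by_cases hs : π p = s
  · rw [← Set.ncard_exchange (s := {x | x ∈ A ∧ π x = s}) (a := p) (b := q)
      (fun h => hp h.1) ⟨hq, hpq ▸ hs⟩]
    congr 1
    ext x
    simp only [Set.mem_ofPred_eq, Set.mem_insert_iff, Set.mem_sdiff, Set.mem_singleton_iff]
    constructor
    · rintro ⟨h1 | h1, h2⟩ <;> tauto
    · rintro (h1 | h1)
      · subst h1; exact ⟨Or.inl rfl, hs⟩
      · tauto
  · congr 1
    ext x
    simp only [Set.mem_ofPred_eq, Set.mem_insert_iff, Set.mem_sdiff, Set.mem_singleton_iff]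
    constructor
    · rintro ⟨h1 | h1, h2⟩
      · subst h1; exact absurd h2 hs
      · tauto
    · rintro ⟨h1, h2⟩
      refine ⟨Or.inr ⟨h1, fun h3 => hs ?_⟩, h2⟩
      rw [hpq, ← h3]; exact h2

theorem Good2.exchange {P : RawProc N} {u t : N.Amb} {B A E F : Set N.Amb}
    {l₁ : N.Amb → N.S} {k₁ : N.Amb → N.T} {l₂ : N.Amb → N.S} {k₂ : N.Amb → N.T}
    (h : Good2 P u t B A E F l₁ k₁ l₂ k₂) {p q : N.Amb} (hp : p ∈ B) (hq : q ∈ A)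
    (hpq : P.piS p = P.piS q) :
    Good2 P u t (insert q (B \ {p})) (insert p (A \ {q})) E F l₁ k₁ l₂ k₂ := by
  have hpA : p ∉ A := fun hh => h.dAB p hh hp
  have hqB : q ∉ B := h.dAB q hq
  have hne : p ≠ q := fun e => hpA (e ▸ hq)
  refine ⟨⟨h.g1.fresh, ?_, (h.g1.finC.sdiff).insert _, h.g1.finD, h.g1.disj, ?_, h.g1.cPost⟩,
    h.tfresh, h.tu, ?_, ?_, (h.finA.sdiff).insert _, h.finF, h.disjF, h.disjFE, ?_, h.cPost⟩
  · rintro x (rfl | hx)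
    · exact h.sub hq
    · exact h.g1.sub hx.1
  · intro s
    rw [count_exchange hp hqB hpq.symm]; exact h.g1.cPre s
  · rintro x (rfl | hx)
    · exact h.g1.sub hp
    · exact h.sub hx.1
  · rintro x (rfl | hx) (hx' | hx')
    · exact hne hx'
    · exact hx'.2 rfl
    · exact hx.2 hx'
    · exact h.dAB x hx.1 hx'.1
  · intro s
    rw [count_exchange hq hpA hpq]; exact h.cPre s

theorem Good2.isProc {P : RawProc N} (hP : IsProc N P) (hf : P.FiniteP)
    {u t : N.Amb} {B A E F : Set N.Amb}
    {l₁ : N.Amb → N.S} {k₁ : N.Amb → N.T} {l₂ : N.Amb → N.S} {k₂ : N.Amb → N.T}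
    (h : Good2 P u t B A E F l₁ k₁ l₂ k₂) :
    IsProc N (procExt (procExt P u B E l₁ k₁) t A F l₂ k₂) :=
  procExt_isProc (procExt_isProc hP hf h.g1) (procExt_finite hf) (h.good hP)

theorem Good2.unordered {P : RawProc N} (hP : IsProc N P) (hf : P.FiniteP)
    {u t : N.Amb} {B A E F : Set N.Amb}
    {l₁ : N.Amb → N.S} {k₁ : N.Amb → N.T} {l₂ : N.Amb → N.S} {k₂ : N.Amb → N.T}
    (h : Good2 P u t B A E F l₁ k₁ l₂ k₂) {p q : N.Amb} (hp : p ∈ P.ends) (hq : q ∈ P.ends) :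
    ¬ (procExt (procExt P u B E l₁ k₁) t A F l₂ k₂).causal (Sum.inl p) (Sum.inl q) := by
  intro hc
  have hqF : q ∉ F := fun hh => h.disjF q hh hq.1
  have hqE : q ∉ E := fun hh => h.g1.disj q hh hq.1
  rcases procExt_causal (procExt_isProc hP hf h.g1) (h.good hP) hc with h1 | ⟨_, _, h1⟩
  · simp [rk, hqF] at h1
  rcases procExt_causal hP h.g1 h1 with h1 | ⟨_, _, h1⟩
  · simp [rk, hqE] at h1
  rcases Relation.TransGen.head'_iff.1 h1 with ⟨c, hc, _⟩
  rcases c with c | c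
  · exact hc
  · have hc : 0 < P.Fst p c := hc
    have := hp.2 c
    omega

theorem Good2.oneSwap {P : RawProc N} (hP : IsProc N P) (hf : P.FiniteP)
    {u t : N.Amb} {B A E F : Set N.Amb}
    {l₁ : N.Amb → N.S} {k₁ : N.Amb → N.T} {l₂ : N.Amb → N.S} {k₂ : N.Amb → N.T}
    (h : Good2 P u t B A E F l₁ k₁ l₂ k₂) {p q : N.Amb} (hp : p ∈ B) (hq : q ∈ A)
    (hpq : P.piS p = P.piS q) :
    OneSwap N (procExt (procExt P u B E l₁ k₁) t A F l₂ k₂)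
      (procExt (procExt P u (insert q (B \ {p})) E l₁ k₁) t (insert p (A \ {q})) F l₂ k₂) := by
  have hpe := h.g1.sub hp
  have hqe := h.sub hq
  have hpA : p ∉ A := fun hh => h.dAB p hh hp
  have hqB : q ∉ B := h.dAB q hq
  have hne : p ≠ q := fun e => hpA (e ▸ hq)
  refine ⟨h.isProc hP hf, (h.exchange hp hq hpq).isProc hP hf, p, q,
    ⟨Or.inl (Or.inl hpe.1), Or.inl (Or.inl hqe.1), ?_, h.unordered hP hf hpe hqe,
      h.unordered hP hf hqe hpe⟩, ?_⟩
  · simp [procExt, hpe.1, hqe.1, hpq]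
  · have : (procExt (procExt P u B E l₁ k₁) t A F l₂ k₂).swap p q =
      (procExt (procExt P u (insert q (B \ {p})) E l₁ k₁) t (insert p (A \ {q})) F l₂ k₂) := by
      simp only [RawProc.swap, procExt, RawProc.mk.injEq, true_and]
      refine ⟨?_, rfl, rfl⟩
      funext x v
      have e1 := hpe.2 v
      have e2 := hqe.2 v
      by_cases hxp : x = p
      · subst hxp
        simp [hqB, hq, hne, e1, e2]
      · by_cases hxq : x = q
        · subst hxq
          simp [hpA, hp, hxp, e1, e2]
        · have m1 : x ∈ insert p (A \ {q}) ↔ x ∈ A := by simp [hxp, hxq]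
          have m2 : x ∈ insert q (B \ {p}) ↔ x ∈ B := by simp [hxp, hxq]
          simp only [hxp, hxq, if_false]
          by_cases hxA : x ∈ A <;> by_cases hxB : x ∈ B <;>
            simp only [hxA, hxB, m1.2, if_true, if_false] <;>
            simp only [if_pos, if_neg, m1, m2, hxA, hxB, not_false_eq_true]
    rw [this]
    exact iso_refl _

theorem Good2.swaps {P : RawProc N} (hP : IsProc N P) (hf : P.FiniteP)
    {u t : N.Amb} {B A E F : Set N.Amb}
    {l₁ : N.Amb → N.S} {k₁ : N.Amb → N.T} {l₂ : N.Amb → N.S} {k₂ : N.Amb → N.T}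
    (h : Good2 P u t B A E F l₁ k₁ l₂ k₂) (σ : N.Amb → N.Amb) {I : Set N.Amb} (hI : I.Finite)
    (hIB : I ⊆ B) (hσ : ∀ x ∈ I, σ x ∈ A) (hinj : Set.InjOn σ I)
    (hl : ∀ x ∈ I, P.piS (σ x) = P.piS x) :
    Good2 P u t ((B \ I) ∪ σ '' I) ((A \ σ '' I) ∪ I) E F l₁ k₁ l₂ k₂ ∧
    SwapEqv N (procExt (procExt P u B E l₁ k₁) t A F l₂ k₂)
      (procExt (procExt P u ((B \ I) ∪ σ '' I) E l₁ k₁) t ((A \ σ '' I) ∪ I) F l₂ k₂) := by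
  induction I, hI using Set.Finite.induction_on with
  | empty =>
    simp only [Set.image_empty, Set.sdiff_empty, Set.union_empty]
    exact ⟨h, Relation.ReflTransGen.refl⟩
  | @insert p I hpI hI ih =>
    have hsub : I ⊆ insert p I := Set.subset_insert _ _
    have hpm : p ∈ insert p I := Set.mem_insert _ _
    obtain ⟨hg, hs⟩ := ih (hsub.trans hIB) (fun x hx => hσ x (hsub hx)) (hinj.mono hsub)
      (fun x hx => hl x (hsub hx))
    have hpB := hIB hpm
    have hqA := hσ p hpm
    have hqI : σ p ∉ σ '' I := by
      rintro ⟨y, hy, e⟩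
      have := hinj (hsub hy) hpm e
      exact hpI (this ▸ hy)
    have hpσ : ∀ y ∈ I, p ≠ σ y := fun y hy e =>
      h.dAB (σ y) (hσ y (hsub hy)) (e ▸ hpB)
    have hqB : σ p ∉ B := h.dAB _ hqA
    have hpA : p ∉ A := fun hh => h.dAB p hh hpB
    have hp' : p ∈ (B \ I) ∪ σ '' I := Or.inl ⟨hpB, hpI⟩
    have hq' : σ p ∈ (A \ σ '' I) ∪ I := Or.inl ⟨hqA, hqI⟩
    have e1 : insert (σ p) (((B \ I) ∪ σ '' I) \ {p}) = (B \ insert p I) ∪ σ '' (insert p I) := by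
      rw [Set.image_insert_eq]
      ext x
      simp only [Set.mem_insert_iff, Set.mem_sdiff, Set.mem_union, Set.mem_singleton_iff]
      have : x ∈ σ '' I → x ≠ p := by
        rintro ⟨y, hy, rfl⟩ e
        exact hpσ y hy e.symm
      clear * - this
      tauto
    have e2 : insert p (((A \ σ '' I) ∪ I) \ {σ p}) = (A \ σ '' (insert p I)) ∪ insert p I := by
      rw [Set.image_insert_eq]
      ext x
      simp only [Set.mem_insert_iff, Set.mem_sdiff, Set.mem_union, Set.mem_singleton_iff]
      have : x ∈ I → x ≠ σ p := by
        rintro hx rfl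
        exact hqB (hIB (hsub hx))
      clear * - this
      tauto
    have g := hg.exchange hp' hq' (hl p hpm).symm
    have o := hg.oneSwap hP hf hp' hq' (hl p hpm).symm
    rw [e1, e2] at g o
    exact ⟨g, hs.tail o⟩

open Classical in
theorem Good2.iso {P : RawProc N} (hP : IsProc N P) (hf : P.FiniteP)
    {u t u' t' : N.Amb} {B A E F E' D : Set N.Amb}
    {l₁ l₂ l₁' l₂' : N.Amb → N.S} {k₁ k₂ k₁' k₂' : N.Amb → N.T}
    (h : Good2 P u t' B A E F l₁ k₁ l₂ k₂)
    (h' : Good2 P t u' A B D E' l₁' k₁' l₂' k₂')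
    (g f : N.Amb → N.Amb) (hg : Set.BijOn g E E') (hff : Set.BijOn f F D)
    (hgl : ∀ x ∈ E, l₂' (g x) = l₁ x) (hfl : ∀ x ∈ F, l₁' (f x) = l₂ x)
    (hk1 : k₂' u' = k₁ u) (hk2 : k₁' t = k₂ t') :
    Iso N (procExt (procExt P u B E l₁ k₁) t' A F l₂ k₂)
      (procExt (procExt P t A D l₁' k₁') u' B E' l₂' k₂') := by
  have hE := h.g1.disj
  have hF := h.disjF
  have hFE := h.disjFE
  have hD := h'.g1.disj
  have hE' := h'.disjF
  have hED := h'.disjFE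
  have hu := h.g1.fresh
  have ht' := h.tfresh
  have htu := h.tu
  have ht := h'.g1.fresh
  have hu' := h'.tfresh
  have htu' := h'.tu
  let fp : N.Amb → N.Amb := fun x => if x ∈ P.pl then x else if x ∈ E then g x else f x
  let ft : N.Amb → N.Amb := fun v => if v ∈ P.tr then v else if v = u then u' else t
  have fp1 : ∀ x ∈ P.pl, fp x = x := fun x hx => by simp [fp, hx]
  have fp2 : ∀ x ∈ E, fp x = g x := fun x hx => by simp [fp, hx, hE x hx]
  have fp3 : ∀ x ∈ F, fp x = f x := fun x hx => by simp [fp, hFE x hx, hF x hx]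
  have ft1 : ∀ x ∈ P.tr, ft x = x := fun x hx => by simp [ft, hx]
  have ft2 : ft u = u' := by simp [ft, hu]
  have ft3 : ft t' = t := by simp [ft, ht', htu]
  have hgm : ∀ x ∈ E, g x ∈ E' := hg.mapsTo
  have hfm : ∀ x ∈ F, f x ∈ D := hff.mapsTo
  have hi1 := procExt_init (procExt_isProc hP hf h.g1) (h.good hP)
  have hi2 := procExt_init (procExt_isProc hP hf h'.g1) (h'.good hP)
  rw [procExt_init hP h.g1] at hi1
  rw [procExt_init hP h'.g1] at hi2
  have hBp : ∀ x ∈ B, x ∈ P.pl := fun x hx => (h.g1.sub hx).1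
  have hAp : ∀ x ∈ A, x ∈ P.pl := fun x hx => (h.sub hx).1
  refine ⟨fp, ft, ⟨?_, ?_, ?_⟩, ⟨?_, ?_, ?_⟩, ?_, ?_, ?_, ?_⟩
  · rintro x ((hx | hx) | hx)
    · rw [fp1 x hx]; exact Or.inl (Or.inl hx)
    · rw [fp2 x hx]; exact Or.inr (hgm x hx)
    · rw [fp3 x hx]; exact Or.inl (Or.inr (hfm x hx))
  · rintro x ((hx | hx) | hx) y ((hy | hy) | hy) e
    · rwa [fp1 x hx, fp1 y hy] at e
    · rw [fp1 x hx, fp2 y hy] at e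
      exact absurd (e ▸ hx) (hE' _ (hgm y hy))
    · rw [fp1 x hx, fp3 y hy] at e
      exact absurd (e ▸ hx) (hD _ (hfm y hy))
    · rw [fp2 x hx, fp1 y hy] at e
      exact absurd (e ▸ hy) (hE' _ (hgm x hx))
    · rw [fp2 x hx, fp2 y hy] at e
      exact hg.injOn hx hy e
    · rw [fp2 x hx, fp3 y hy] at e
      exact absurd (e ▸ hfm y hy) (hED _ (hgm x hx))
    · rw [fp3 x hx, fp1 y hy] at e
      exact absurd (e ▸ hy) (hD _ (hfm x hx))
    · rw [fp3 x hx, fp2 y hy] at e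
      exact absurd (e ▸ hfm x hx) (hED _ (hgm y hy))
    · rw [fp3 x hx, fp3 y hy] at e
      exact hff.injOn hx hy e
  · rintro y ((hy | hy) | hy)
    · exact ⟨y, Or.inl (Or.inl hy), fp1 y hy⟩
    · obtain ⟨x, hx, rfl⟩ := hff.surjOn hy
      exact ⟨x, Or.inr hx, fp3 x hx⟩
    · obtain ⟨x, hx, rfl⟩ := hg.surjOn hy
      exact ⟨x, Or.inl (Or.inr hx), fp2 x hx⟩
  · rintro x (rfl | rfl | hx)
    · rw [ft3]; exact Or.inr (Or.inl rfl)
    · rw [ft2]; exact Or.inl rfl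
    · rw [ft1 x hx]; exact Or.inr (Or.inr hx)
  · rintro x (rfl | rfl | hx) y (rfl | rfl | hy) e
    · rfl
    · rw [ft3, ft2] at e; exact absurd e.symm htu'
    · rw [ft3, ft1 y hy] at e; exact absurd (e ▸ hy) ht
    · rw [ft3, ft2] at e; exact absurd e htu'
    · rfl
    · rw [ft2, ft1 y hy] at e; exact absurd (e ▸ hy) hu'
    · rw [ft3, ft1 x hx] at e; exact absurd (e ▸ hx) ht
    · rw [ft2, ft1 x hx] at e; exact absurd (e ▸ hx) hu'
    · rwa [ft1 x hx, ft1 y hy] at e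
  · rintro y (rfl | rfl | hy)
    · exact ⟨u, Or.inr (Or.inl rfl), ft2⟩
    · exact ⟨t', Or.inl rfl, ft3⟩
    · exact ⟨y, Or.inr (Or.inr hy), ft1 y hy⟩
  · skip
    have key : ∀ x ∈ (procExt (procExt P u B E l₁ k₁) t' A F l₂ k₂).pl,
        (fp x ∈ A ↔ x ∈ A) ∧ (fp x ∈ B ↔ x ∈ B) ∧ (fp x ∈ D ↔ x ∈ F) ∧ (fp x ∈ E' ↔ x ∈ E) ∧
        (x ∈ P.pl ∧ fp x = x ∨ x ∉ P.pl ∧ fp x ∉ P.pl) := by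
      rintro x ((hx | hx) | hx)
      · rw [fp1 x hx]
        have a1 : x ∉ D := fun hh => hD x hh hx
        have a2 : x ∉ F := fun hh => hF x hh hx
        have a3 : x ∉ E := fun hh => hE x hh hx
        have a4 : x ∉ E' := fun hh => hE' x hh hx
        tauto
      · rw [fp2 x hx]
        have a0 := hgm x hx
        have a1 := hE x hx
        have a2 := hE' _ a0
        have a3 := hED _ a0
        have a4 : x ∉ F := fun hh => hFE x hh hx
        have a5 := hAp x
        have a6 := hBp x
        have a7 := hAp (g x)
        have a8 := hBp (g x)
        tauto
      · rw [fp3 x hx]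
        have a0 := hfm x hx
        have a1 := hF x hx
        have a2 := hD _ a0
        have a3 := hFE x hx
        have a4 : f x ∉ E' := fun hh => hED _ hh a0
        have a5 := hAp x
        have a6 := hBp x
        have a7 := hAp (f x)
        have a8 := hBp (f x)
        tauto
    intro x hx v hv
    obtain ⟨kA, kB, kD, kE, kP⟩ := key x hx
    rcases hv with rfl | rfl | hv
    · rw [ft3]
      simp [procExt, kA, kD, htu'.symm]
    · rw [ft2]
      simp [procExt, kB, kE, htu.symm]
    · rw [ft1 v hv]
      have n1 : v ≠ t := fun e => ht (e ▸ hv)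
      have n2 : v ≠ t' := fun e => ht' (e ▸ hv)
      have n3 : v ≠ u := fun e => hu (e ▸ hv)
      have n4 : v ≠ u' := fun e => hu' (e ▸ hv)
      simp only [procExt, n1, n2, n3, n4, if_false]
      rcases kP with ⟨_, e⟩ | ⟨e1, e2⟩
      · rw [e]; exact ⟨rfl, rfl⟩
      · rw [hP.fst_zero (Or.inl e1), hP.fst_zero (Or.inl e2), hP.fts_zero (Or.inl e1),
          hP.fts_zero (Or.inl e2)]
        exact ⟨rfl, rfl⟩
  · intro x hx
    rw [hi1, hi2]
    rcases hx with (hx | hx) | hx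
    · rw [fp1 x hx]
    · rw [fp2 x hx]
      exact ⟨fun hh => absurd hh.1 (hE x hx), fun hh => absurd hh.1 (hE' _ (hgm x hx))⟩
    · rw [fp3 x hx]
      exact ⟨fun hh => absurd hh.1 (hF x hx), fun hh => absurd hh.1 (hD _ (hfm x hx))⟩
  · rintro x ((hx | hx) | hx)
    · rw [fp1 x hx]; simp [procExt, hx]
    · rw [fp2 x hx]
      have a0 := hgm x hx
      simp [procExt, hx, hE x hx, hE' _ a0, hED _ a0, hgl x hx]
    · rw [fp3 x hx]
      have a0 := hfm x hx
      simp [procExt, hF x hx, hFE x hx, hD _ a0, a0, hfl x hx]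
  · rintro v (rfl | rfl | hv)
    · rw [ft3]; simp [procExt, ht, ht', htu, hk2]
    · rw [ft2]; simp [procExt, hu, hu', htu', hk1]
    · rw [ft1 v hv]; simp [procExt, hv]

theorem exists_label_inj {α β : Type*} [Nonempty α] (π : α → β) {I Z : Set α} (hI : I.Finite)
    (hc : ∀ s, {x | x ∈ I ∧ π x = s}.ncard ≤ {x | x ∈ Z ∧ π x = s}.ncard) :
    ∃ σ : α → α, (∀ x ∈ I, σ x ∈ Z) ∧ Set.InjOn σ I ∧ ∀ x ∈ I, π (σ x) = π x := by
  have : ∀ s, ∃ f : α → α, (∀ x, x ∈ I ∧ π x = s → f x ∈ Z ∧ π (f x) = s) ∧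
      Set.InjOn f {x | x ∈ I ∧ π x = s} := by
    intro s
    have hfin : {x | x ∈ I ∧ π x = s}.Finite := hI.subset fun x hx => hx.1
    obtain ⟨f, h1, h2⟩ := hfin.exists_injOn_of_encard_le (t := {x | x ∈ Z ∧ π x = s}) (by
      rw [← hfin.cast_ncard_eq]
      by_cases hz : {x | x ∈ Z ∧ π x = s}.Finite
      · rw [← hz.cast_ncard_eq]; exact_mod_cast hc s
      · rw [Set.Infinite.encard_eq hz]; exact le_top)
    exact ⟨f, fun x hx => h1 hx, h2⟩
  choose f h1 h2 using this
  refine ⟨fun x => f (π x) x, fun x hx => (h1 _ x ⟨hx, rfl⟩).1, ?_,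
    fun x hx => (h1 _ x ⟨hx, rfl⟩).2⟩
  intro x hx y hy e
  have e' : f (π x) x = f (π y) y := e
  have a1 := (h1 _ x ⟨hx, rfl⟩).2
  have a2 := (h1 _ y ⟨hy, rfl⟩).2
  have hpi : π x = π y := by rw [← a1, e', a2]
  rw [← hpi] at e'
  exact h2 (π x) ⟨hx, rfl⟩ ⟨hy, hpi.symm⟩ e'

/-- A relabelled fresh copy of a finite labelled set of places. -/
theorem exists_copy {P : RawProc N} (hP : IsProc N P) (hf : P.FiniteP)
    {E : Set N.Amb} (hE : E.Finite) (l : N.Amb → N.S) :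
    ∃ (E' : Set N.Amb) (l' : N.Amb → N.S) (g g' : N.Amb → N.Amb), E'.Finite ∧
      (∀ x ∈ E', x ∉ P.pl) ∧ Set.BijOn g E E' ∧ Set.BijOn g' E' E ∧
      (∀ x ∈ E, l' (g x) = l x) ∧ (∀ x ∈ E', l (g' x) = l' x) ∧
      ∀ s, {x | x ∈ E' ∧ l' x = s}.ncard = {x | x ∈ E ∧ l x = s}.ncard := by
  have : Nonempty N.Amb := ⟨(∅ : Set (N.S ⊕ N.T ⊕ ℕ))⟩
  obtain ⟨g, h1, h2⟩ := exists_fresh_places hP hf hE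
  have hinv : ∀ x ∈ E, Function.invFunOn g E (g x) = x := fun x hx => h2.leftInvOn_invFunOn hx
  refine ⟨g '' E, fun y => l (Function.invFunOn g E y), g, Function.invFunOn g E, hE.image _,
    ?_, h2.bijOn_image, ?_, ?_, fun _ _ => rfl, ?_⟩
  · rintro _ ⟨x, hx, rfl⟩; exact h1 x hx
  · refine ⟨?_, ?_, ?_⟩
    · rintro _ ⟨x, hx, rfl⟩; rw [hinv x hx]; exact hx
    · rintro _ ⟨x, hx, rfl⟩ _ ⟨y, hy, rfl⟩ e
      rw [hinv x hx, hinv y hy] at e; rw [e]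
    · intro x hx; exact ⟨g x, ⟨x, hx, rfl⟩, hinv x hx⟩
  · intro x hx; simp only [hinv x hx]
  · intro s
    have : {x | x ∈ g '' E ∧ l (Function.invFunOn g E x) = s} = g '' {x | x ∈ E ∧ l x = s} := by
      ext y
      constructor
      · rintro ⟨⟨x, hx, rfl⟩, h⟩
        rw [hinv x hx] at h
        exact ⟨x, ⟨hx, h⟩, rfl⟩
      · rintro ⟨x, ⟨hx, h⟩, rfl⟩
        exact ⟨⟨x, hx, rfl⟩, by rw [hinv x hx]; exact h⟩
    show Set.ncard {x | x ∈ g '' E ∧ l (Function.invFunOn g E x) = s} = _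
    rw [this]
    exact Set.ncard_image_of_injOn (h2.mono fun x hx => hx.1)

theorem count_image {π : N.Amb → N.S} {A I : Set N.Amb} {σ : N.Amb → N.Amb} (hA : A.Finite)
    (hIA : I ⊆ A) (hσ : ∀ x ∈ I, σ x ∉ A) (hinj : Set.InjOn σ I)
    (hl : ∀ x ∈ I, π (σ x) = π x) (s : N.S) :
    {x | x ∈ (A \ I) ∪ σ '' I ∧ π x = s}.ncard = {x | x ∈ A ∧ π x = s}.ncard := by
  have hI := hA.subset hIA
  have e : {x | x ∈ (A \ I) ∪ σ '' I ∧ π x = s} =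
      {x | x ∈ A \ I ∧ π x = s} ∪ σ '' {x | x ∈ I ∧ π x = s} := by
    ext y
    constructor
    · rintro ⟨h | ⟨x, hx, rfl⟩, h2⟩
      · exact Or.inl ⟨h, h2⟩
      · exact Or.inr ⟨x, ⟨hx, by rw [← hl x hx]; exact h2⟩, rfl⟩
    · rintro (⟨h, h2⟩ | ⟨x, ⟨hx, h2⟩, rfl⟩)
      · exact ⟨Or.inl h, h2⟩
      · exact ⟨Or.inr ⟨x, hx, rfl⟩, by rw [hl x hx]; exact h2⟩
  have e' : {x | x ∈ A ∧ π x = s} = {x | x ∈ A \ I ∧ π x = s} ∪ {x | x ∈ I ∧ π x = s} := by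
    ext y
    simp only [Set.mem_ofPred_eq, Set.mem_union, Set.mem_sdiff]
    have := @hIA y
    tauto
  have f1 : {x | x ∈ A \ I ∧ π x = s}.Finite := hA.subset fun x hx => hx.1.1
  have f2 : {x | x ∈ I ∧ π x = s}.Finite := hI.subset fun x hx => hx.1
  rw [e, e', Set.ncard_union_eq _ f1 (f2.image _), Set.ncard_union_eq _ f1 f2,
    Set.ncard_image_of_injOn (hinj.mono fun x hx => hx.1)]
  · rw [Set.disjoint_left]; rintro x ⟨h1, _⟩ ⟨h2, _⟩; exact h1.2 h2
  · rw [Set.disjoint_left]; rintro _ ⟨h1, _⟩ ⟨x, h2, rfl⟩; exact hσ x h2.1 h1.1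

end Helpers

/-- In a binary-conflict-free net, if `P —a→ P'` and `P —b→ Q` with `a ≠ b`,
then the step `{a,b}` is enabled at `ĤP`, and there is `Q'` with `P' —b→ Q'`
and `Q —a→ Q'' ≡₁* Q'` for some `Q''`. -/
theorem bcf_process_diamond (N : Net) (hN : N.BinaryConflictFree)
    (P P' Q : RawProc N) (a b : N.T) (hab : a ≠ b)
    (hP : IsProc N P) (hP' : IsProc N P') (hQ : IsProc N Q) (hPf : P.FiniteP)
    (h1 : StepExt N P P' a) (h2 : StepExt N P Q b) :
    N.Enabled P.endMark (Finsupp.single a 1 + Finsupp.single b 1) ∧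
    ∃ Q' Q'', IsProc N Q' ∧ IsProc N Q'' ∧ StepExt N P' Q' b ∧
      StepExt N Q Q'' a ∧ SwapEqv N Q'' Q' := by
  obtain ⟨t, A, D, l₁, k₁, gA, ka, rfl⟩ := stepExt_eq hP hP' h1
  obtain ⟨u, B, E, l₂, k₂, gB, kb, rfl⟩ := stepExt_eq hP hQ h2
  have hreach := endMark_reachable _ P hP hPf rfl
  have hen : N.Enabled P.endMark (Finsupp.single a 1 + Finsupp.single b 1) := by
    by_contra hne
    refine hN _ hreach (Finsupp.single a 1 + Finsupp.single b 1) ?_ ⟨?_, hne, ?_⟩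
    · rw [Finsupp.sum_add_index' (by simp) (by simp)]
      simp
    · intro h0
      have := DFunLike.congr_fun h0 a
      simp at this
    · intro v hv
      by_cases hva : v = a
      · subst hva
        have : (Finsupp.single v 1 + Finsupp.single b 1 : N.T →₀ ℕ) v = 1 := by
          simp [hab.symm]
        rw [this, enabled_single, ← ka]
        exact good_enabled hP hPf gA
      · by_cases hvb : v = b
        · subst hvb
          have : (Finsupp.single a 1 + Finsupp.single v 1 : N.T →₀ ℕ) v = 1 := by
            simp [hab]
          rw [this, enabled_single, ← kb]
          exact good_enabled hP hPf gB
        · simp [Ne.symm hva, Ne.symm hvb, Finsupp.single_apply] at hv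
  refine ⟨hen, ?_⟩
  rw [enabled_pair] at hen
  have : Nonempty N.Amb := ⟨t⟩
  have hIf : (A ∩ B).Finite := gA.finC.subset Set.inter_subset_left
  obtain ⟨σ, hσZ, hinj, hl⟩ := exists_label_inj P.piS (I := A ∩ B) (Z := P.ends \ (A ∪ B)) hIf (by
    intro s
    have c := hen s
    rw [← ka, ← kb, gA.cPre, gB.cPre] at c
    have f1 : {x | x ∈ A ∧ P.piS x = s}.Finite := gA.finC.subset fun x hx => hx.1
    have f2 : {x | x ∈ B ∧ P.piS x = s}.Finite := gB.finC.subset fun x hx => hx.1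
    have c2 := Set.ncard_union_add_ncard_inter _ _ f1 f2
    have e1 : {x | x ∈ A ∧ P.piS x = s} ∩ {x | x ∈ B ∧ P.piS x = s} =
        {x | x ∈ A ∩ B ∧ P.piS x = s} := by
      ext x; simp only [Set.mem_inter_iff, Set.mem_ofPred_eq]; tauto
    have e2 : {x | x ∈ P.ends \ (A ∪ B) ∧ P.piS x = s} = {x | x ∈ P.ends ∧ P.piS x = s} \
        ({x | x ∈ A ∧ P.piS x = s} ∪ {x | x ∈ B ∧ P.piS x = s}) := by
      ext x; simp only [Set.mem_union, Set.mem_sdiff, Set.mem_ofPred_eq]; tauto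
    rw [e1] at c2
    rw [e2, Set.ncard_sdiff _ (f1.union f2)]
    · change _ ≤ P.endMark s - _
      omega
    · rintro x (⟨h, h'⟩ | ⟨h, h'⟩)
      · exact ⟨gA.sub h, h'⟩
      · exact ⟨gB.sub h, h'⟩)
  obtain ⟨E', l₂', g, _, fE', dE', bg, _, lg, _, cE'⟩ :=
    exists_copy hP' (procExt_finite hPf) gB.finD l₂
  obtain ⟨F, l₁', _, f, fF, dF, _, bf, _, lf, cF⟩ :=
    exists_copy hQ (procExt_finite hPf) gA.finD l₁
  obtain ⟨u', hu'⟩ := exists_fresh_tr hP' (procExt_finite hPf)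
  obtain ⟨t', ht'⟩ := exists_fresh_tr hQ (procExt_finite hPf)
  have hσA : ∀ x ∈ A ∩ B, σ x ∉ A := fun x hx hh => (hσZ x hx).2 (Or.inl hh)
  have hσB : ∀ x ∈ A ∩ B, σ x ∉ B := fun x hx hh => (hσZ x hx).2 (Or.inr hh)
  set A' : Set N.Amb := (A \ (A ∩ B)) ∪ σ '' (A ∩ B) with hA'
  set B' : Set N.Amb := (B \ (A ∩ B)) ∪ σ '' (A ∩ B) with hB'
  have G1 : Good2 P u t' B A' E F l₂ k₂ l₁' (fun _ => a) := by
    refine ⟨gB, fun h => ht' (Or.inr h), fun h => ht' (Or.inl h), ?_, ?_,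
      (gA.finC.sdiff).union (hIf.image _), fF, fun x hx h => dF x hx (Or.inl h),
      fun x hx h => dF x hx (Or.inr h), ?_, ?_⟩
    · rintro _ (h | ⟨x, hx, rfl⟩)
      · exact gA.sub h.1
      · exact (hσZ x hx).1
    · rintro _ (h | ⟨x, hx, rfl⟩) hB
      · exact h.2 ⟨h.1, hB⟩
      · exact hσB x hx hB
    · intro s
      rw [hA', count_image gA.finC Set.inter_subset_left hσA hinj hl, ← gA.cPre, ka]
    · intro s
      rw [cF, ← gA.cPost, ka]
  have G2 : Good2 P t u' A B' D E' l₁ k₁ l₂' (fun _ => b) := by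
    refine ⟨gA, fun h => hu' (Or.inr h), fun h => hu' (Or.inl h), ?_, ?_,
      (gB.finC.sdiff).union (hIf.image _), fE', fun x hx h => dE' x hx (Or.inl h),
      fun x hx h => dE' x hx (Or.inr h), ?_, ?_⟩
    · rintro _ (h | ⟨x, hx, rfl⟩)
      · exact gB.sub h.1
      · exact (hσZ x hx).1
    · rintro _ (h | ⟨x, hx, rfl⟩) hB
      · exact h.2 ⟨hB, h.1⟩
      · exact hσA x hx hB
    · intro s
      rw [hB', count_image gB.finC Set.inter_subset_right hσB hinj hl, ← gB.cPre, kb]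
    · intro s
      rw [cE', ← gB.cPost, kb]
  obtain ⟨G3, hsw⟩ := G1.swaps hP hPf σ hIf Set.inter_subset_right
    (fun x hx => Or.inr ⟨x, hx, rfl⟩) hinj hl
  have eA : (A' \ σ '' (A ∩ B)) ∪ (A ∩ B) = A := by
    ext x
    have : x ∈ σ '' (A ∩ B) → x ∉ A := by
      rintro ⟨y, hy, rfl⟩; exact hσA y hy
    simp only [hA', Set.mem_union, Set.mem_sdiff, Set.mem_inter_iff]
    tauto
  rw [eA, ← hB'] at G3 hsw
  have hiso := Good2.iso hP hPf G3 G2 g f bg bf lg lf kb.symm ka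
  obtain ⟨s, hs⟩ := N.pre_ne a
  have hne : ∃ p, p ∈ A := by
    rw [← ka, gA.cPre, ] at hs
    obtain ⟨p, hp⟩ := Set.nonempty_of_ncard_ne_zero hs.ne'
    exact ⟨p, hp.1⟩
  obtain ⟨p, hp⟩ := hne
  refine ⟨_, _, G2.isProc hP hPf, G1.isProc hP hPf, procExt_stepExt hP' (G2.good hP),
    procExt_stepExt hQ (G1.good hP), hsw.tail ?_⟩
  exact oneSwap_of_iso (G3.isProc hP hPf) (G2.isProc hP hPf) hiso
    (p := p) (Or.inl (Or.inl (gA.sub hp).1))
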